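/- arXiv:math/0512369 — 2 statements merged into one kernel-verified Lean document; each statement's English description precedes it below -/
import Mathlib

section
/- Fix m ≥ 1 and n ≥ 0. The map 𝔪 sending an m-colored permutation u of [n] to the sequence (C^(m)(u[1]), C^(m)(u[2]), ..., C^(m)(u[n])) is a bijection from C_m ≀ S_n onto the set of saturated chains ∅ = α⁰ ≺ α¹ ≺ ⋯ ≺ αⁿ from ∅ to rank n in the colored composition poset Co^(m). In particular, the total number of saturated chains from ∅ to rank n equals m^n · n!. -/
/-- `CCover m α β` means `β` covers `α` in the poset `Co^(m)` of `m`-colored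
compositions (parts are pairs (color, size)).  The covers of `∅` are the `m`
one-part compositions of `1`; otherwise `β` is obtained from `α` by
(1) adding `1` to a part keeping its color, (2) adding `1` to a part and
splitting it into two parts of the same color, or (3) splitting a part of color
`c` into `(c,h), (c',1), (c,a-h)` with `c' ≠ c`, parts of size `0` being
deleted. -/
def CCover (m : ℕ) (α β : List (Fin m × ℕ)) : Prop :=
  (α = [] ∧ ∃ c : Fin m, β = [(c, 1)]) ∨
  (∃ (l r : List (Fin m × ℕ)) (c : Fin m) (a : ℕ),
      α = l ++ (c, a) :: r ∧ β = l ++ (c, a + 1) :: r) ∨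
  (∃ (l r : List (Fin m × ℕ)) (c : Fin m) (a h : ℕ), h < a ∧
      α = l ++ (c, a) :: r ∧ β = l ++ (c, h + 1) :: (c, a - h) :: r) ∨
  (∃ (l r : List (Fin m × ℕ)) (c c' : Fin m) (a h : ℕ), c' ≠ c ∧ h ≤ a ∧
      α = l ++ (c, a) :: r ∧
      β = l ++ ((if h = 0 then [] else [(c, h)]) ++ (c', 1) ::
            (if h = a then [] else [(c, a - h)])) ++ r)

/-- The colored descent composition of a colored word (a list of
(color, value) pairs): the list of (color, length) pairs of the maximal
increasing constant-color runs. -/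
def cdc {m : ℕ} : List (Fin m × ℕ) → List (Fin m × ℕ)
  | [] => []
  | (c, v) :: rest =>
    match rest, cdc rest with
    | (c₂, v₂) :: _, (c₃, len) :: t =>
        if c = c₂ ∧ v < v₂ then (c, len + 1) :: t else (c, 1) :: (c₃, len) :: t
    | _, _ => [(c, 1)]

/-- The colored word of an `m`-colored permutation `(w, f)` of `[n]`: the letter
in position `i` is the value `w i` with color `f (w i)`. -/
def cword {m n : ℕ} (w : Equiv.Perm (Fin n)) (f : Fin n → Fin m) :
    List (Fin m × ℕ) :=
  (List.finRange n).map fun i => (f (w i), (w i : ℕ))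

/-- The map `𝔪` of Theorem 2.1: it sends an `m`-colored permutation `u` of `[n]`
to the sequence `(C^(m)(u[1]), …, C^(m)(u[n]))`, where `u[i]` is the restriction
of `u` to letters of value at most `i`. -/
def mchain (m n : ℕ) (u : Equiv.Perm (Fin n) × (Fin n → Fin m)) :
    Fin (n + 1) → List (Fin m × ℕ) :=
  fun i => cdc ((cword u.1 u.2).filter fun p => decide (p.2 < (i : ℕ)))

namespace CW

variable {m : ℕ}

/-- the letters `p q` may be adjacent in one run -/
def J (p q : Fin m × ℕ) : Prop := p.1 = q.1 ∧ p.2 < q.2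

/-- no run passes through the junction of `x` and `y` -/
def Br (x y : List (Fin m × ℕ)) : Prop :=
  ∀ p ∈ x.getLast?, ∀ q ∈ y.head?, ¬ J p q

/-- increasing word of constant color `c` -/
def Run (c : Fin m) (b : List (Fin m × ℕ)) : Prop :=
  (∀ p ∈ b, p.1 = c) ∧ b.Pairwise (fun p q => p.2 < q.2)

theorem cdc_shape (p : Fin m × ℕ) (r : List (Fin m × ℕ)) :
    ∃ k t, cdc (p :: r) = (p.1, k + 1) :: t := by
  induction r generalizing p with
  | nil => exact ⟨0, [], by simp [cdc]⟩
  | cons q r ih =>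
    obtain ⟨k, t, h⟩ := ih q
    obtain ⟨c, v⟩ := p
    obtain ⟨c₂, v₂⟩ := q
    rw [cdc.eq_def]
    simp only [h]
    split_ifs
    · exact ⟨_, _, rfl⟩
    · exact ⟨0, _, rfl⟩

theorem cdc_single (p : Fin m × ℕ) : cdc [p] = [(p.1, 1)] := by
  simp [cdc]

theorem cdc_J {p q : Fin m × ℕ} {r : List (Fin m × ℕ)} (hJ : J p q) {c k t}
    (h : cdc (q :: r) = (c, k) :: t) : cdc (p :: q :: r) = (p.1, k + 1) :: t := by
  obtain ⟨c, v⟩ := p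
  obtain ⟨c₂, v₂⟩ := q
  rw [cdc.eq_def]
  simp only [h]
  exact if_pos hJ

theorem cdc_nJ {p q : Fin m × ℕ} {r : List (Fin m × ℕ)} (hJ : ¬ J p q) :
    cdc (p :: q :: r) = (p.1, 1) :: cdc (q :: r) := by
  obtain ⟨k, t, h⟩ := cdc_shape q r
  obtain ⟨c, v⟩ := p
  obtain ⟨c₂, v₂⟩ := q
  rw [cdc.eq_def]
  simp only [h]
  exact if_neg hJ

theorem cdc_eq_nil {w : List (Fin m × ℕ)} (h : cdc w = []) : w = [] := by
  cases w with
  | nil => rfl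
  | cons p r => obtain ⟨k, t, h'⟩ := cdc_shape p r; simp [h'] at h

theorem cdc_nil : cdc ([] : List (Fin m × ℕ)) = [] := by simp [cdc]

theorem Br_nil_left (y : List (Fin m × ℕ)) : Br [] y := by simp [Br]
theorem Br_nil_right (y : List (Fin m × ℕ)) : Br y [] := by simp [Br]

theorem cdc_append (x y : List (Fin m × ℕ)) (h : Br x y) : cdc (x ++ y) = cdc x ++ cdc y := by
  induction x with
  | nil => simp [cdc_nil]
  | cons p x ih =>
    cases x with
    | nil =>
      cases y with
      | nil => simp [cdc_nil]
      | cons q y =>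
        have : ¬ J p q := h p (by simp) q (by simp)
        simp [cdc_nJ this, cdc_single]
    | cons p' x =>
      have ih' := ih (by intro a ha b hb; exact h a (by simpa [List.getLast?_cons_cons] using ha) b hb)
      obtain ⟨k, t, hk⟩ := cdc_shape p' x
      by_cases hJ : J p p'
      · rw [cdc_J hJ hk]
        rw [hk] at ih'
        simp only [List.cons_append] at ih' ⊢
        rw [cdc_J hJ ih']
      · rw [cdc_nJ hJ]
        simp only [List.cons_append] at ih' ⊢
        rw [cdc_nJ hJ, ih']

theorem cdc_run {c : Fin m} {b : List (Fin m × ℕ)} (h : Run c b) (hb : b ≠ []) :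
    cdc b = [(c, b.length)] := by
  induction b with
  | nil => exact absurd rfl hb
  | cons p b ih =>
    cases b with
    | nil => simp [cdc_single, h.1 p (by simp)]
    | cons q b =>
      have h1 := h.1
      have h2 := h.2
      rw [List.pairwise_cons] at h2
      have := ih ⟨fun p hp => h1 p (by simp [hp]), h2.2⟩ (by simp)
      have hJ : J p q := ⟨by rw [h1 p (by simp), h1 q (by simp)], h2.1 q (by simp)⟩
      rw [cdc_J hJ this, h1 p (by simp)]
      simp

theorem split1 {w : List (Fin m × ℕ)} {c a r} (h : cdc w = (c, a) :: r) :
    ∃ b y, w = b ++ y ∧ Run c b ∧ b ≠ [] ∧ b.length = a ∧ Br b y ∧ cdc y = r := by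
  induction w generalizing c a r with
  | nil => simp [cdc_nil] at h
  | cons p w ih =>
    cases w with
    | nil =>
      rw [cdc_single] at h
      simp at h
      refine ⟨[p], [], by simp, ⟨?_, ?_⟩, by simp, ?_, Br_nil_right _, ?_⟩
      · simp [h.1.1]
      · simp
      · simp [h.1.2]
      · rw [cdc_nil, h.2]
    | cons q w =>
      obtain ⟨k, t, hk⟩ := cdc_shape q w
      by_cases hJ : J p q
      · rw [cdc_J hJ hk] at h
        simp at h
        obtain ⟨b, y, h1, h2, h3, h4, h5, h6⟩ := ih hk
        cases b with
        | nil => exact absurd rfl h3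
        | cons q' b =>
          simp only [List.cons_append, List.cons.injEq] at h1
          obtain ⟨rfl, rfl⟩ := h1
          refine ⟨p :: q :: b, y, by simp, ⟨?_, ?_⟩, by simp, ?_, ?_, ?_⟩
          · intro x hx
            rw [List.mem_cons] at hx
            rcases hx with rfl | hx
            · exact h.1.1
            · rw [h2.1 x hx, ← hJ.1, h.1.1]
          · rw [List.pairwise_cons]
            refine ⟨?_, h2.2⟩
            intro x hx
            rw [List.mem_cons] at hx
            rcases hx with rfl | hx
            · exact hJ.2
            · exact hJ.2.trans ((List.pairwise_cons.1 h2.2).1 x hx)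
          · rw [List.length_cons, h4]; exact h.1.2
          · intro u hu v hv
            exact h5 u (by simpa [List.getLast?_cons_cons] using hu) v hv
          · rw [h6, h.2]
      · rw [cdc_nJ hJ] at h
        simp at h
        refine ⟨[p], q :: w, by simp, ⟨?_, ?_⟩, by simp, ?_, ?_, ?_⟩
        · simp [h.1.1]
        · simp
        · simp [h.1.2]
        · intro u hu v hv
          simp at hu hv
          subst hu hv
          exact hJ
        · exact h.2

theorem Br_app_left {x z y : List (Fin m × ℕ)} (h : Br z y) (hz : z ≠ []) : Br (x ++ z) y := by
  intro p hp q hq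
  rw [List.getLast?_append_of_ne_nil _ hz] at hp
  exact h p hp q hq

theorem Br_app_right {x z y : List (Fin m × ℕ)} (h : Br x z) (hz : z ≠ []) : Br x (z ++ y) := by
  intro p hp q hq
  rw [List.head?_append_of_ne_nil _ hz] at hq
  exact h p hp q hq

theorem Br_of_app_right {x z y : List (Fin m × ℕ)} (h : Br x (z ++ y)) : Br x z := by
  by_cases hz : z = []
  · subst hz; exact Br_nil_right _
  intro p hp q hq
  exact h p hp q (by rw [List.head?_append_of_ne_nil _ hz]; exact hq)

theorem Br_of_app_left {x z y : List (Fin m × ℕ)} (h : Br (x ++ z) y) : Br z y := by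
  by_cases hz : z = []
  · subst hz; exact Br_nil_left _
  intro p hp q hq
  exact h p (by rw [List.getLast?_append_of_ne_nil _ hz]; exact hp) q hq

theorem split {l r w : List (Fin m × ℕ)} (h : cdc w = l ++ r) :
    ∃ x y, w = x ++ y ∧ cdc x = l ∧ cdc y = r ∧ Br x y := by
  induction l generalizing w with
  | nil => exact ⟨[], w, rfl, cdc_nil, h, Br_nil_left _⟩
  | cons p l ih =>
    obtain ⟨c, a⟩ := p
    obtain ⟨b, y0, rfl, h2, h3, h4, h5, h6⟩ := split1 h
    obtain ⟨x, y, rfl, e1, e2, e3⟩ := ih h6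
    refine ⟨b ++ x, y, by simp, ?_, e2, ?_⟩
    · rw [cdc_append _ _ (Br_of_app_right h5), cdc_run h2 h3, e1, h4]; rfl
    · by_cases hx : x = []
      · subst hx; simpa using h5
      · exact Br_app_left e3 hx

/-- full decomposition around a part -/
theorem split3 {l r w : List (Fin m × ℕ)} {c a} (h : cdc w = l ++ (c, a) :: r) :
    ∃ x b y, w = x ++ (b ++ y) ∧ cdc x = l ∧ Run c b ∧ b ≠ [] ∧ b.length = a ∧ cdc y = r ∧
      Br x b ∧ Br b y := by
  obtain ⟨x, z, rfl, h1, h2, h3⟩ := split h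
  obtain ⟨b, y, rfl, h4, h5, h6, h7, h8⟩ := split1 h2
  exact ⟨x, b, y, rfl, h1, h4, h5, h6, h8, Br_of_app_right h3, h7⟩

theorem Br_max (N : ℕ) (c : Fin m) (x y : List (Fin m × ℕ)) (hy : ∀ p ∈ y, p.2 < N) :
    Br (x ++ [(c, N)]) y := by
  intro p hp q hq
  simp at hp
  subst hp
  intro hJ
  have := hJ.2
  have := hy q (List.mem_of_mem_head? hq)
  simp at *
  omega

theorem Br_col {x y : List (Fin m × ℕ)}
    (h : ∀ p ∈ x.getLast?, ∀ q ∈ y.head?, p.1 ≠ q.1) : Br x y :=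
  fun p hp q hq hJ => h p hp q hq hJ.1

theorem Run.left {c : Fin m} {x y} (h : Run c (x ++ y)) : Run c x :=
  ⟨fun p hp => h.1 p (by simp [hp]), (List.pairwise_append.1 h.2).1⟩
theorem Run.right {c : Fin m} {x y} (h : Run c (x ++ y)) : Run c y :=
  ⟨fun p hp => h.1 p (by simp [hp]), (List.pairwise_append.1 h.2).2.1⟩
theorem Run.snoc {c : Fin m} {x} {N : ℕ} (h : Run c x) (hN : ∀ p ∈ x, p.2 < N) :
    Run c (x ++ [(c, N)]) := by
  refine ⟨?_, ?_⟩
  · intro p hp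
    simp at hp
    rcases hp with hp | rfl
    · exact h.1 p hp
    · rfl
  · rw [List.pairwise_append]
    exact ⟨h.2, by simp, by simpa using fun a b hab => hN (a, b) hab⟩

/-- insertion of the maximal letter, same color, inside a run -/
theorem ins_same {N : ℕ} {c : Fin m} {x b1 b2 y : List (Fin m × ℕ)}
    (hN : ∀ p ∈ x ++ b1 ++ b2 ++ y, p.2 < N) (hr : Run c (b1 ++ b2))
    (h1 : Br x (b1 ++ [(c, N)])) (h2 : Br b2 y) (hb2 : b2 ≠ []) :
    cdc (x ++ b1 ++ (c, N) :: (b2 ++ y)) =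
      cdc x ++ (c, b1.length + 1) :: (c, b2.length) :: cdc y := by
  have e : x ++ b1 ++ (c, N) :: (b2 ++ y) = x ++ ((b1 ++ [(c, N)]) ++ (b2 ++ y)) := by simp
  rw [e, cdc_append _ _ (Br_app_right h1 (by simp)), cdc_append _ _ (Br_max _ _ _ _ ?_),
    cdc_append _ _ h2, cdc_run (hr.left.snoc ?_) (by simp), cdc_run hr.right hb2]
  · simp
  · intro p hp; apply hN; simp [hp]
  · intro p hp; apply hN; simp at hp; simp; tauto

/-- insertion of the maximal letter, same color, at the end of a run -/
theorem ins_end {N : ℕ} {c : Fin m} {x b y : List (Fin m × ℕ)}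
    (hN : ∀ p ∈ x ++ b ++ y, p.2 < N) (hr : Run c b)
    (h1 : Br x b) (hb : b ≠ []) :
    cdc (x ++ b ++ (c, N) :: y) =
      cdc x ++ (c, b.length + 1) :: cdc y := by
  have e : x ++ b ++ (c, N) :: y = x ++ ((b ++ [(c, N)]) ++ y) := by simp
  rw [e, cdc_append _ _ (Br_app_right (Br_app_right h1 hb) (by simp)),
    cdc_append _ _ (Br_max _ _ _ _ ?_), cdc_run (hr.snoc ?_) (by simp)]
  · simp
  · intro p hp; apply hN; simp [hp]
  · intro p hp; apply hN; simp [hp]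

/-- insertion of the maximal letter, different color -/
theorem ins_diff {N : ℕ} {c c' : Fin m} {x b1 b2 y : List (Fin m × ℕ)} (hc : c' ≠ c)
    (hN : ∀ p ∈ x ++ b1 ++ b2 ++ y, p.2 < N) (hr : Run c (b1 ++ b2))
    (h1 : Br x (b1 ++ [(c', N)])) (h2 : Br b2 y) :
    cdc (x ++ b1 ++ (c', N) :: (b2 ++ y)) =
      cdc x ++ ((if b1.length = 0 then [] else [(c, b1.length)]) ++ (c', 1) ::
            (if b2.length = 0 then [] else [(c, b2.length)])) ++ cdc y := by
  have e : x ++ b1 ++ (c', N) :: (b2 ++ y) = x ++ ((b1 ++ [(c', N)]) ++ (b2 ++ y)) := by simp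
  have key : ∀ b, Run c b → cdc b = (if b.length = 0 then [] else [(c, b.length)]) := by
    intro b hb
    split_ifs with h
    · rw [List.length_eq_zero_iff.1 h, cdc_nil]
    · exact cdc_run hb (by rintro rfl; simp at h)
  rw [e, cdc_append _ _ (Br_app_right h1 (by simp)), cdc_append _ _ (Br_max _ _ _ _ ?_),
    cdc_append _ _ h2, cdc_append b1 _ (Br_col ?_), cdc_single, key _ hr.left, key _ hr.right]
  · simp
  · intro p hp q hq
    simp at hq
    subst hq
    rw [hr.1 p (by simp [List.mem_of_getLast? hp])]
    exact hc.symm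
  · intro p hp; apply hN; simp at hp; simp; tauto

theorem last_col {l x : List (Fin m × ℕ)} {p q} (h : cdc x = l) (hp : p ∈ x.getLast?)
    (hq : q ∈ l.getLast?) : p.1 = q.1 := by
  obtain ⟨l', rfl⟩ : ∃ l', l = l' ++ [q] := List.getLast?_eq_some_iff.1 hq
  obtain ⟨c, a⟩ := q
  obtain ⟨x, b, y, rfl, h1, h2, h3, h4, h5, h6, h7⟩ := split3 h
  obtain rfl := cdc_eq_nil h5
  simp only [List.append_nil] at hp
  rw [List.getLast?_append_of_ne_nil _ h3] at hp
  exact h2.1 p (List.mem_of_getLast? hp)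

/-- surjectivity in case 3 -/
theorem surj3 {N : ℕ} {w l r : List (Fin m × ℕ)} {c a h} (hN : ∀ p ∈ w, p.2 < N) (hh : h < a)
    (hw : cdc w = l ++ (c, a) :: r) :
    ∃ x y c', w = x ++ y ∧ cdc (x ++ (c', N) :: y) = l ++ (c, h + 1) :: (c, a - h) :: r := by
  induction l using List.reverseRecOn generalizing a h r with
  | nil =>
    obtain ⟨x, b, y, rfl, h1, h2, h3, h4, h5, h6, h7⟩ := split3 hw
    obtain rfl := cdc_eq_nil h1
    have hb := List.take_append_drop h b
    refine ⟨b.take h, b.drop h ++ y, c, ?_, ?_⟩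
    · conv_lhs => rw [← hb]
      simp only [List.append_assoc, List.nil_append]
    have hd : b.drop h ≠ [] := by simp; omega
    have := ins_same (N := N) (c := c) (x := []) (b1 := b.take h) (b2 := b.drop h) (y := y)
      (by simpa using hN) (by rwa [hb]) (Br_nil_left _)
      (Br_of_app_left (x := b.take h) (by rwa [hb])) hd
    simp only [List.nil_append] at this
    rw [this, h5]
    simp [cdc_nil, h4, hh.le]
  | append_singleton l p ih =>
    obtain ⟨d, a'⟩ := p
    by_cases hcase : h = 0 ∧ d = c
    · obtain ⟨rfl, rfl⟩ := hcase
      have hw' : cdc w = l ++ (d, a') :: (d, a) :: r := by simpa using hw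
      have ha' : 0 < a' := by
        obtain ⟨x, b, y, rfl, h1, h2, h3, h4, h5, h6, h7⟩ := split3 hw'
        rw [← h4]; exact List.length_pos_iff.2 h3
      obtain ⟨x, y, c', e1, e2⟩ := ih (h := a' - 1) (by omega) hw'
      refine ⟨x, y, c', e1, ?_⟩
      rw [e2]
      have q1 : a' - 1 + 1 = a' := by omega
      have q2 : a' - (a' - 1) = 1 := by omega
      rw [q1, q2]
      simp
    · obtain ⟨x, b, y, rfl, h1, h2, h3, h4, h5, h6, h7⟩ := split3 hw
      have hb := List.take_append_drop h b
      refine ⟨x ++ b.take h, b.drop h ++ y, c, ?_, ?_⟩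
      · conv_lhs => rw [← hb]
        simp only [List.append_assoc, List.nil_append]
      have hd : b.drop h ≠ [] := by simp; omega
      have := ins_same (N := N) (c := c) (x := x) (b1 := b.take h) (b2 := b.drop h) (y := y)
        (by simpa using hN) (by rwa [hb]) ?_
        (Br_of_app_left (x := b.take h) (by rwa [hb])) hd
      · rw [this, h5, h1]
        simp [h4, hh.le]
      · by_cases h0 : h = 0
        · subst h0
          apply Br_col
          intro p hp q hq
          simp at hq
          subst hq
          rw [last_col h1 hp (q := (d, a')) (by simp)]
          simpa using hcase
        · have ht : b.take h ≠ [] := by simp [h0, h3]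
          exact Br_app_right (Br_of_app_right (y := b.drop h) (by rwa [hb])) ht

theorem surj {N : ℕ} {w β : List (Fin m × ℕ)} (hN : ∀ p ∈ w, p.2 < N)
    (hc : CCover m (cdc w) β) :
    ∃ x y c', w = x ++ y ∧ cdc (x ++ (c', N) :: y) = β := by
  rcases hc with ⟨h, c, rfl⟩ | ⟨l, r, c, a, h, rfl⟩ | ⟨l, r, c, a, h, hh, hw, rfl⟩ |
    ⟨l, r, c, c', a, h, hne, hle, hw, rfl⟩
  · obtain rfl := cdc_eq_nil h
    exact ⟨[], [], c, rfl, by simp [cdc_single]⟩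
  · obtain ⟨x, b, y, rfl, h1, h2, h3, h4, h5, h6, h7⟩ := split3 h
    refine ⟨x ++ b, y, c, by simp, ?_⟩
    rw [ins_end (by simpa using hN) h2 h6 h3, h1, h5, h4]
  · exact surj3 hN hh hw
  · by_cases hcase : h = 0 ∧ ∃ l' a', l = l' ++ [(c', a')]
    · obtain ⟨rfl, l', a', rfl⟩ := hcase
      have hw' : cdc w = l' ++ (c', a') :: (c, a) :: r := by simpa using hw
      have ha' : 0 < a' := by
        obtain ⟨x, b, y, rfl, h1, h2, h3, h4, h5, h6, h7⟩ := split3 hw'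
        rw [← h4]; exact List.length_pos_iff.2 h3
      have ha : 0 < a := by
        obtain ⟨x, b, y, rfl, h1, h2, h3, h4, h5, h6, h7⟩ := split3 hw
        rw [← h4]; exact List.length_pos_iff.2 h3
      obtain ⟨x, y, c'', e1, e2⟩ := surj3 (h := a' - 1) hN (by omega) hw'
      refine ⟨x, y, c'', e1, ?_⟩
      rw [e2]
      have q1 : a' - 1 + 1 = a' := by omega
      have q2 : a' - (a' - 1) = 1 := by omega
      rw [q1, q2]
      simp [ha.ne]
    · obtain ⟨x, b, y, rfl, h1, h2, h3, h4, h5, h6, h7⟩ := split3 hw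
      have hb := List.take_append_drop h b
      refine ⟨x ++ b.take h, b.drop h ++ y, c', ?_, ?_⟩
      · conv_lhs => rw [← hb]
        simp only [List.append_assoc, List.nil_append]
      rw [ins_diff (N := N) (c := c) (x := x) (b1 := b.take h) (b2 := b.drop h) (y := y)
        hne (by simpa using hN) (by rwa [hb]) ?_ ?_]
      · have q : (b.drop h).length = 0 ↔ h = a := by simp; omega
        have q' : (b.take h).length = h := by simp; omega
        simp only [q, q', h1, h5]
        simp [h4]
      · by_cases h0 : h = 0
        · subst h0
          apply Br_col
          intro p hp q hq
          simp at hq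
          subst hq
          rcases List.eq_nil_or_concat' l with rfl | ⟨l', ⟨d, a'⟩, rfl⟩
          · obtain rfl := cdc_eq_nil h1
            simp at hp
          rw [last_col h1 hp (q := (d, a')) (by simp)]
          rintro rfl
          exact hcase ⟨rfl, l', a', rfl⟩
        · have ht : b.take h ≠ [] := by simp [h0, h3]
          exact Br_app_right (Br_of_app_right (y := b.drop h) (by rwa [hb])) ht
      · exact Br_of_app_left (x := b.take h) (by rwa [hb])

/-- decomposition around a gap -/
theorem gap (x y : List (Fin m × ℕ)) (h : x ++ y ≠ []) :
    ∃ X b1 b2 Y c, x = X ++ b1 ∧ y = b2 ++ Y ∧ Run c (b1 ++ b2) ∧ b1 ++ b2 ≠ [] ∧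
      Br X (b1 ++ b2) ∧ Br (b1 ++ b2) Y ∧ (b1 = [] → X = []) := by
  have first : ∀ w : List (Fin m × ℕ), w ≠ [] → ∃ c b y, w = b ++ y ∧ Run c b ∧ b ≠ [] ∧
      Br b y := by
    intro w hw
    cases w with
    | nil => exact absurd rfl hw
    | cons p w =>
      obtain ⟨k, t, hk⟩ := cdc_shape p w
      obtain ⟨b, y, e1, e2, e3, e4, e5, e6⟩ := split1 hk
      exact ⟨_, b, y, e1, e2, e3, e5⟩
  induction x with
  | nil =>
    obtain ⟨c, b, Y, e1, e2, e3, e4⟩ := first y (by simpa using h)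
    exact ⟨[], [], b, Y, c, rfl, e1, by simpa using e2, by simpa using e3, Br_nil_left _,
      by simpa using e4, fun _ => rfl⟩
  | cons p x ih =>
    cases x with
    | nil =>
      obtain ⟨c, b, Y, e1, e2, e3, e4⟩ := first (p :: y) (by simp)
      cases b with
      | nil => exact absurd rfl e3
      | cons p' b =>
        simp at e1
        obtain ⟨rfl, rfl⟩ := e1
        exact ⟨[], [p], b, Y, c, rfl, rfl, e2, by simp, Br_nil_left _, e4, by simp⟩
    | cons p' x =>
      obtain ⟨X, b1, b2, Y, c, e1, rfl, e3, e4, e5, e6, e7⟩ := ih (by simp)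
      cases X with
      | cons q X =>
        have hb1 : b1 ≠ [] := fun h => by simpa using e7 h
        refine ⟨p :: q :: X, b1, b2, Y, c, by rw [e1]; rfl, rfl, e3, e4, ?_, e6,
          fun h => absurd h hb1⟩
        exact Br_app_left (x := [p]) e5 (by simp)
      | nil =>
        simp only [List.nil_append] at e1
        subst e1
        by_cases hJ : J p p'
        · refine ⟨[], p :: p' :: x, b2, Y, c, rfl, rfl, ⟨?_, ?_⟩, by simp, Br_nil_left _, ?_,
            fun _ => rfl⟩
          · intro z hz
            simp only [List.cons_append] at hz
            rw [List.mem_cons] at hz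
            rcases hz with rfl | hz
            · rw [hJ.1]; exact e3.1 _ (by simp)
            · exact e3.1 z hz
          · have h2 := e3.2
            simp only [List.cons_append] at h2 ⊢
            rw [List.pairwise_cons]
            refine ⟨?_, h2⟩
            intro z hz
            rw [List.mem_cons] at hz
            rcases hz with rfl | hz
            · exact hJ.2
            · exact hJ.2.trans ((List.pairwise_cons.1 h2).1 z hz)
          · exact Br_app_left (x := [p]) e6 (by simp)
        · refine ⟨[p], p' :: x, b2, Y, c, rfl, rfl, e3, by simp, ?_, e6, by simp⟩
          intro u hu v hv
          simp at hu hv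
          subst hu hv
          exact hJ

theorem fwd {N : ℕ} (x y : List (Fin m × ℕ)) (c' : Fin m) (hN : ∀ p ∈ x ++ y, p.2 < N) :
    CCover m (cdc (x ++ y)) (cdc (x ++ (c', N) :: y)) := by
  by_cases h : x ++ y = []
  · simp at h
    obtain ⟨rfl, rfl⟩ := h
    exact Or.inl ⟨by simp [cdc_nil], c', by simp [cdc_single]⟩
  obtain ⟨X, b1, b2, Y, c, rfl, rfl, e3, e4, e5, e6, e7⟩ := gap x y h
  have hα : cdc (X ++ b1 ++ (b2 ++ Y)) = cdc X ++ (c, (b1 ++ b2).length) :: cdc Y := by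
    have : X ++ b1 ++ (b2 ++ Y) = X ++ ((b1 ++ b2) ++ Y) := by simp
    rw [this, cdc_append _ _ (Br_app_right e5 e4), cdc_append _ _ e6, cdc_run e3 e4]
    rfl
  have hbr : ∀ z, Br X (b1 ++ [z]) := by
    intro z
    by_cases hb1 : b1 = []
    · rw [e7 hb1]; exact Br_nil_left _
    · exact Br_app_right (Br_of_app_right e5) hb1
  have hN' : ∀ p ∈ X ++ b1 ++ b2 ++ Y, p.2 < N := by simpa using hN
  rw [hα]
  by_cases hc : c' = c
  · subst hc
    by_cases hb2 : b2 = []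
    · subst hb2
      right; left
      refine ⟨cdc X, cdc Y, c', _, rfl, ?_⟩
      simp only [List.append_nil, List.nil_append] at *
      rw [ins_end hN' e3 e5 e4]
    · right; right; left
      have : 0 < b2.length := List.length_pos_iff.2 hb2
      refine ⟨cdc X, cdc Y, c', _, b1.length, ?_, rfl, ?_⟩
      · simp; omega
      · rw [ins_same hN' e3 (hbr _) (Br_of_app_left e6) hb2]
        simp
  · right; right; right
    refine ⟨cdc X, cdc Y, c, c', _, b1.length, hc, ?_, rfl, ?_⟩
    · simp
    · rw [ins_diff hc hN' e3 (hbr _) (Br_of_app_left e6)]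
      have : (b1.length = (b1 ++ b2).length) ↔ b2.length = 0 := by simp
      simp only [this]
      simp

/-- remove the first cell -/
def pop : List (Fin m × ℕ) → List (Fin m × ℕ)
  | [] => []
  | (_, 0) :: t => t
  | (_, 1) :: t => t
  | (c, k + 2) :: t => (c, k + 1) :: t

theorem pop_cdc (p : Fin m × ℕ) (w : List (Fin m × ℕ)) : pop (cdc (p :: w)) = cdc w := by
  cases w with
  | nil => simp [cdc_single, cdc_nil, pop]
  | cons q w =>
    obtain ⟨k, t, h⟩ := cdc_shape q w
    by_cases hJ : J p q
    · rw [cdc_J hJ h, h, pop, hJ.1]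
    · rw [cdc_nJ hJ, pop]

theorem head_col {p q : Fin m × ℕ} {w w'} (h : cdc (p :: w) = cdc (q :: w')) : p.1 = q.1 := by
  obtain ⟨k, t, h1⟩ := cdc_shape p w
  obtain ⟨k', t', h2⟩ := cdc_shape q w'
  rw [h1, h2] at h
  simp at h
  exact h.1.1

theorem J_iff {p p' q q' : Fin m × ℕ} {w w'} (h : cdc (p :: q :: w) = cdc (p' :: q' :: w')) :
    J p q ↔ J p' q' := by
  obtain ⟨k, t, h1⟩ := cdc_shape q w
  obtain ⟨k', t', h2⟩ := cdc_shape q' w'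
  by_cases hJ : J p q <;> by_cases hJ' : J p' q' <;> simp only [hJ, hJ']
  · rw [cdc_J hJ h1, cdc_nJ hJ'] at h; simp at h
  · rw [cdc_nJ hJ, cdc_J hJ' h2] at h; simp at h

theorem inj_aux {N : ℕ} {c' : Fin m} (x y : List (Fin m × ℕ)) (p : Fin m × ℕ) (hp : p.2 < N)
    (hN : ∀ q ∈ x ++ y, q.2 < N) (hbr : Br [p] (x ++ (c', N) :: y))
    (h : cdc (p :: (x ++ y)) = cdc (x ++ (c', N) :: y)) : False := by
  induction x generalizing p with
  | nil =>
    have hc := head_col h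
    exact hbr p (by simp) (c', N) (by simp) ⟨hc, hp⟩
  | cons q x ih =>
    have hnJ : ¬ J p q := hbr p (by simp) q (by simp)
    have h' := congrArg pop h
    simp only [List.cons_append] at h h'
    rw [pop_cdc, pop_cdc] at h'
    refine ih q (hN q (by simp)) (fun z hz => hN z (by simp at hz; simp; tauto)) ?_ h'
    intro a ha b hb
    simp at ha
    subst ha
    obtain ⟨z, hz⟩ : ∃ z, x ++ (c', N) :: y = b :: z := by
      cases hh : x ++ (c', N) :: y with
      | nil => simp at hh
      | cons b' z => rw [hh] at hb; simp at hb; exact ⟨z, by rw [hb]⟩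
    rw [hz] at h
    rwa [← J_iff h]

theorem inj {N : ℕ} {c c' : Fin m} (x y x' y' : List (Fin m × ℕ)) (hw : x ++ y = x' ++ y')
    (hN : ∀ q ∈ x ++ y, q.2 < N) (h : cdc (x ++ (c, N) :: y) = cdc (x' ++ (c', N) :: y')) :
    x ++ (c, N) :: y = x' ++ (c', N) :: y' := by
  have main : ∀ (c c' : Fin m) (y x' y' : List (Fin m × ℕ)) (p : Fin m × ℕ),
      y = p :: x' ++ y' → (∀ q ∈ y, q.2 < N) →
      cdc ((c, N) :: y) = cdc (p :: x' ++ (c', N) :: y') → False := by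
    rintro c c' _ x' y' p rfl hN h
    have h' := congrArg pop h
    simp only [List.cons_append] at h h'
    rw [pop_cdc, pop_cdc] at h'
    refine inj_aux x' y' p (hN p (by simp)) (fun z hz => hN z (by simp at hz; simp; tauto)) ?_ h'
    intro a ha b hb
    simp at ha
    subst ha
    obtain ⟨z, hz⟩ : ∃ z, x' ++ (c', N) :: y' = b :: z := by
      cases hh : x' ++ (c', N) :: y' with
      | nil => simp at hh
      | cons b' z => rw [hh] at hb; simp at hb; exact ⟨z, by rw [hb]⟩
    rw [hz] at h
    rw [← J_iff h]
    intro hJ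
    have h1 := hJ.2
    have h2 := hN p (by simp)
    simp at h1
    omega
  induction x generalizing x' with
  | nil =>
    cases x' with
    | nil =>
      have := head_col h
      simp at this hw
      simp [this, hw]
    | cons p x' => exact (main c c' y x' y' p (by simpa using hw) (by simpa using hN) h).elim
  | cons q x ih =>
    cases x' with
    | nil =>
      refine (main c' c y' x y q (by simpa using hw.symm) ?_ h.symm).elim
      rw [hw] at hN; simpa using hN
    | cons p x' =>
      simp only [List.cons_append, List.cons.injEq] at hw
      have h' := congrArg pop h
      simp only [List.cons_append] at h'
      rw [pop_cdc, pop_cdc] at h'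
      have := ih x' hw.2 (fun z hz => hN z (by simp at hz; simp; tauto)) h'
      simp [this, hw.1]

/-- restriction to small letters -/
def res (L : List (Fin m × ℕ)) (i : ℕ) : List (Fin m × ℕ) :=
  L.filter fun p => decide (p.2 < i)

theorem res_lt (L : List (Fin m × ℕ)) (i : ℕ) : ∀ p ∈ res L i, p.2 < i := by
  intro p hp
  simpa using (List.mem_filter.1 hp).2

theorem res_succ {L : List (Fin m × ℕ)} {i : ℕ} (hnd : (L.map Prod.snd).Nodup)
    (hi : i ∈ L.map Prod.snd) :
    ∃ x y c, res L i = x ++ y ∧ res L (i + 1) = x ++ (c, i) :: y := by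
  obtain ⟨⟨c, j⟩, h1, h2⟩ := List.mem_map.1 hi
  simp only at h2
  subst h2
  obtain ⟨s, t, rfl⟩ := List.append_of_mem h1
  have key : ∀ s : List (Fin m × ℕ), (∀ p ∈ s, p.2 ≠ j) → res s (j + 1) = res s j := by
    intro s hs
    apply List.filter_congr
    intro p hp
    have := hs p hp
    simp only [decide_eq_decide]
    omega
  rw [List.map_append, List.map_cons, List.nodup_append] at hnd
  obtain ⟨_, n2, n3⟩ := hnd
  rw [List.nodup_cons] at n2
  have ks := key s (fun p hp he => n3 p.2 (List.mem_map_of_mem hp) j (by simp) he)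
  have kt := key t (fun p hp he => n2.1 (List.mem_map.2 ⟨p, hp, he⟩))
  refine ⟨res s j, res t j, c, ?_, ?_⟩
  · simp [res]
  · rw [← ks, ← kt]
    simp [res]

theorem cword_snd {n : ℕ} (w : Equiv.Perm (Fin n)) (f : Fin n → Fin m) :
    (cword w f).map Prod.snd = (List.finRange n).map (fun i => (w i : ℕ)) := by
  simp [cword, Function.comp_def]

theorem cword_nodup {n : ℕ} (w : Equiv.Perm (Fin n)) (f : Fin n → Fin m) :
    ((cword w f).map Prod.snd).Nodup := by
  rw [cword_snd]
  exact (List.nodup_finRange n).map (fun a b h => w.injective (Fin.ext h))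

theorem cword_mem {n : ℕ} (w : Equiv.Perm (Fin n)) (f : Fin n → Fin m) {i : ℕ} (hi : i < n) :
    i ∈ (cword w f).map Prod.snd := by
  rw [cword_snd, List.mem_map]
  exact ⟨w.symm ⟨i, hi⟩, by simp, by simp⟩

theorem mchain_eq {n : ℕ} (u : Equiv.Perm (Fin n) × (Fin n → Fin m)) (i : Fin (n + 1)) :
    mchain m n u i = cdc (res (cword u.1 u.2) i) := rfl

theorem res_zero (L : List (Fin m × ℕ)) : res L 0 = [] := by simp [res]

theorem res_all (L : List (Fin m × ℕ)) (n : ℕ) (h : ∀ p ∈ L, p.2 < n) : res L n = L := by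
  simpa [res] using h

theorem cword_lt {n : ℕ} (w : Equiv.Perm (Fin n)) (f : Fin n → Fin m) :
    ∀ p ∈ cword w f, p.2 < n := by
  intro p hp
  simp [cword] at hp
  obtain ⟨a, rfl⟩ := hp
  simp

theorem mchain_inj (n : ℕ) : Function.Injective (mchain m n) := by
  intro u u' h
  have key : ∀ i ≤ n, res (cword u.1 u.2) i = res (cword u'.1 u'.2) i := by
    intro i
    induction i with
    | zero => intro _; rw [res_zero, res_zero]
    | succ i ih =>
      intro hi
      obtain ⟨x, y, c, e1, e2⟩ := res_succ (cword_nodup u.1 u.2) (cword_mem u.1 u.2 hi)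
      obtain ⟨x', y', c', e1', e2'⟩ := res_succ (cword_nodup u'.1 u'.2) (cword_mem u'.1 u'.2 hi)
      have hc := congrFun h ⟨i + 1, by omega⟩
      rw [mchain_eq, mchain_eq] at hc
      simp only at hc
      rw [e2, e2'] at hc
      have ih' := ih (by omega)
      rw [e2, e2']
      refine inj x y x' y' (by rw [← e1, ← e1', ih']) ?_ hc
      rw [← e1]
      exact res_lt _ _
  have hw := key n le_rfl
  rw [res_all _ _ (cword_lt _ _), res_all _ _ (cword_lt _ _)] at hw
  rw [cword, cword, List.map_inj_left] at hw
  have h1 : u.1 = u'.1 := by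
    ext i
    have := hw i (by simp)
    simp only [Prod.mk.injEq] at this
    exact this.2
  refine Prod.ext h1 ?_
  funext v
  have := hw (u.1.symm v) (by simp)
  simp only [Prod.mk.injEq] at this
  have t := this.1
  rw [← h1] at t
  simpa using t

theorem mchain_cover (n : ℕ) (u : Equiv.Perm (Fin n) × (Fin n → Fin m)) (i : Fin n) :
    CCover m (mchain m n u i.castSucc) (mchain m n u i.succ) := by
  obtain ⟨x, y, c, e1, e2⟩ := res_succ (cword_nodup u.1 u.2) (cword_mem u.1 u.2 i.2)
  rw [mchain_eq, mchain_eq]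
  simp only [Fin.val_castSucc, Fin.val_succ]
  rw [e1, e2]
  apply fwd
  rw [← e1]
  exact res_lt _ _

theorem exists_word {n : ℕ} (c : Fin (n + 1) → List (Fin m × ℕ)) (h0 : c 0 = [])
    (hc : ∀ i : Fin n, CCover m (c i.castSucc) (c i.succ)) (k : ℕ) (hk : k ≤ n) :
    ∃ L : List (Fin m × ℕ), L.length = k ∧ (L.map Prod.snd).Nodup ∧ (∀ p ∈ L, p.2 < k) ∧
      ∀ i (hi : i ≤ k), cdc (res L i) = c ⟨i, by omega⟩ := by
  induction k with
  | zero =>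
    refine ⟨[], rfl, by simp, by simp, ?_⟩
    intro i hi
    obtain rfl : i = 0 := by omega
    rw [res_zero, cdc_nil]
    exact h0.symm
  | succ k ih =>
    obtain ⟨L, l1, l2, l3, l4⟩ := ih (by omega)
    have hcov := hc ⟨k, hk⟩
    have hlast := l4 k le_rfl
    rw [res_all _ _ l3] at hlast
    have hcov' : CCover m (cdc L) (c ⟨k + 1, by omega⟩) := by
      rw [hlast]; exact hcov
    obtain ⟨x, y, d, rfl, e2⟩ := surj l3 hcov'
    refine ⟨x ++ (d, k) :: y, ?_, ?_, ?_, ?_⟩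
    · simp at l1 ⊢; omega
    · have hp : ((x ++ (d, k) :: y).map Prod.snd).Perm (k :: (x ++ y).map Prod.snd) :=
        (List.perm_middle.map Prod.snd)
      rw [hp.nodup_iff, List.nodup_cons]
      refine ⟨?_, l2⟩
      intro hmem
      obtain ⟨p, hp, he⟩ := List.mem_map.1 hmem
      have := l3 p hp
      omega
    · intro p hp
      rw [List.perm_middle.mem_iff, List.mem_cons] at hp
      rcases hp with rfl | hp
      · simp
      · have := l3 p hp; omega
    · intro i hi
      rcases Nat.lt_or_ge k i with hki | hki
      · obtain rfl : i = k + 1 := by omega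
        rw [res_all, e2]
        intro p hp
        rw [List.perm_middle.mem_iff, List.mem_cons] at hp
        rcases hp with rfl | hp
        · simp
        · have := l3 p hp; omega
      · rw [← l4 i hki]
        congr 1
        have : ¬ k < i := by omega
        simp [res, this]

theorem word_cword {n : ℕ} (L : List (Fin m × ℕ)) (hl : L.length = n)
    (hnd : (L.map Prod.snd).Nodup) (hlt : ∀ p ∈ L, p.2 < n) :
    ∃ (w : Equiv.Perm (Fin n)) (f : Fin n → Fin m), cword w f = L := by
  subst hl
  let g : Fin L.length → Fin L.length := fun i => ⟨(L[i]).2, hlt _ (List.getElem_mem _)⟩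
  have hg : Function.Injective g := by
    intro i j hij
    have h : (L[i]).2 = (L[j]).2 := congrArg Fin.val hij
    have := (List.Nodup.getElem_inj_iff hnd (i := i) (j := j) (hi := by simp) (hj := by simp)).1
      (by simpa using h)
    exact Fin.ext this
  let w : Equiv.Perm (Fin L.length) := Equiv.ofBijective g (Finite.injective_iff_bijective.1 hg)
  refine ⟨w, fun v => (L[w.symm v]).1, ?_⟩
  apply List.ext_getElem
  · simp [cword]
  · intro i h1 h2
    simp [cword]
    rfl

end CW

/-- `𝔪` is a bijection from `C_m ≀ S_n` onto the saturated chains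
`∅ = α⁰ ≺ α¹ ≺ ⋯ ≺ αⁿ` from `∅` to rank `n` in `Co^(m)`; in particular the
number of such chains is `m^n * n!`. -/
theorem mchain_bijection (m n : ℕ) (hm : 1 ≤ m) :
    Function.Injective (mchain m n) ∧
    Set.range (mchain m n) = {c : Fin (n + 1) → List (Fin m × ℕ) |
      c 0 = [] ∧ ∀ i : Fin n, CCover m (c i.castSucc) (c i.succ)} ∧
    Nat.card {c : Fin (n + 1) → List (Fin m × ℕ) //
      c 0 = [] ∧ ∀ i : Fin n, CCover m (c i.castSucc) (c i.succ)} =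
      m ^ n * n.factorial := by
  have hrange : Set.range (mchain m n) = {c : Fin (n + 1) → List (Fin m × ℕ) |
      c 0 = [] ∧ ∀ i : Fin n, CCover m (c i.castSucc) (c i.succ)} := by
    ext c
    constructor
    · rintro ⟨u, rfl⟩
      refine ⟨?_, CW.mchain_cover n u⟩
      rw [CW.mchain_eq]
      simp [CW.res_zero, CW.cdc_nil]
    · rintro ⟨h0, hc⟩
      obtain ⟨L, l1, l2, l3, l4⟩ := CW.exists_word c h0 hc n le_rfl
      obtain ⟨w, f, rfl⟩ := CW.word_cword L l1 l2 l3
      refine ⟨(w, f), ?_⟩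
      funext i
      rw [CW.mchain_eq]
      exact l4 i (by omega)
  refine ⟨CW.mchain_inj n, hrange, ?_⟩
  have h := Nat.card_congr (Equiv.ofInjective _ (CW.mchain_inj (m := m) n))
  rw [hrange] at h
  refine Eq.trans h.symm ?_
  simp [Nat.card_eq_fintype_card, Fintype.card_perm, mul_comm]
end

section
/- The number of saturated chains from ∅ to an m-colored composition α of n in Co^(m) equals the number f_n^(m)(α) of m-colored permutations of [n] whose colored descent composition is α. -/
section helpers
variable {m : ℕ}

theorem cdc_step {c c2 c3 : Fin m} {v v2 a : ℕ} {r t : List (Fin m × ℕ)}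
    (e : cdc ((c2, v2) :: r) = (c3, a) :: t) :
    cdc ((c, v) :: (c2, v2) :: r) =
      if c = c2 ∧ v < v2 then (c, a + 1) :: t else (c, 1) :: (c3, a) :: t := by
  rw [cdc]
  exact e

theorem cdc_head (c : Fin m) (v : ℕ) (r : List (Fin m × ℕ)) :
    ∃ a t, cdc ((c, v) :: r) = (c, a + 1) :: t := by
  induction r generalizing c v with
  | nil => exact ⟨0, [], by simp [cdc]⟩
  | cons z r ih =>
    obtain ⟨c2, v2⟩ := z
    obtain ⟨a, t, h⟩ := ih c2 v2
    rw [cdc_step h]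
    by_cases hj : c = c2 ∧ v < v2
    · exact ⟨a + 1, t, by simp [hj]⟩
    · exact ⟨0, (c2, a + 1) :: t, by simp [hj]⟩

theorem cdc_single (c : Fin m) (v : ℕ) : cdc [(c, v)] = [(c, 1)] := by simp [cdc]

theorem cdc_join {c : Fin m} {v v2 : ℕ} (h : v < v2) {r t : List (Fin m × ℕ)} {a : ℕ}
    (e : cdc ((c, v2) :: r) = (c, a) :: t) :
    cdc ((c, v) :: (c, v2) :: r) = (c, a + 1) :: t := by
  rw [cdc_step e]; simp [h]

theorem cdc_nojoin {c c2 : Fin m} {v v2 : ℕ} (h : ¬ (c = c2 ∧ v < v2)) (r : List (Fin m × ℕ)) :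
    cdc ((c, v) :: (c2, v2) :: r) = (c, 1) :: cdc ((c2, v2) :: r) := by
  obtain ⟨a, t, e⟩ := cdc_head c2 v2 r
  rw [cdc_step e, e]; simp [h]

/-- Inserting a maximal letter in front of a word. -/
theorem cdc_max (c : Fin m) (N : ℕ) (r : List (Fin m × ℕ)) (h : ∀ p ∈ r, p.2 < N) :
    cdc ((c, N) :: r) = (c, 1) :: cdc r := by
  cases r with
  | nil => simp [cdc]
  | cons z r =>
    obtain ⟨c2, v2⟩ := z
    have := h (c2, v2) (by simp)
    exact cdc_nojoin (by simp at this; omega) r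

theorem cdc_second_eq (c : Fin m) (v N : ℕ) (r : List (Fin m × ℕ)) (h : ∀ p ∈ r, p.2 < N)
    (hv : v < N) : cdc ((c, v) :: (c, N) :: r) = (c, 2) :: cdc r :=
  cdc_join hv (cdc_max c N r h)

theorem cdc_second_ne (c d : Fin m) (hcd : d ≠ c) (v N : ℕ) (r : List (Fin m × ℕ))
    (h : ∀ p ∈ r, p.2 < N) :
    cdc ((c, v) :: (d, N) :: r) = (c, 1) :: (d, 1) :: cdc r := by
  rw [cdc_nojoin (by tauto), cdc_max d N r h]

theorem cover_front (c d : Fin m) (a : ℕ) (t : List (Fin m × ℕ)) (ha : 0 < a) :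
    CCover m ((c, a) :: t) ((d, 1) :: (c, a) :: t) := by
  by_cases h : d = c
  · subst h
    exact Or.inr (Or.inr (Or.inl ⟨[], t, d, a, 0, ha, by simp, by simp⟩))
  · refine Or.inr (Or.inr (Or.inr ⟨[], t, c, d, a, 0, h, by omega, by simp, ?_⟩))
    simp [ha.ne]

theorem cover_cons (p q : Fin m × ℕ) (L M : List (Fin m × ℕ)) (h : CCover m (q :: L) M) :
    CCover m (p :: q :: L) (p :: M) := by
  rcases h with ⟨h, _⟩ | ⟨l, r, c, a, h1, h2⟩ | ⟨l, r, c, a, k, hk, h1, h2⟩ |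
    ⟨l, r, c, d, a, k, hd, hk, h1, h2⟩
  · simp at h
  · exact Or.inr (Or.inl ⟨p :: l, r, c, a, by simp [h1], by simp [h2]⟩)
  · exact Or.inr (Or.inr (Or.inl ⟨p :: l, r, c, a, k, hk, by simp [h1], by simp [h2]⟩))
  · exact Or.inr (Or.inr (Or.inr ⟨p :: l, r, c, d, a, k, hd, hk, by simp [h1], by simp [h2]⟩))

/-- Unfolding of covers of a nonempty composition by looking at the first part. -/
theorem cover_cons_iff (c : Fin m) (a : ℕ) (t B : List (Fin m × ℕ)) :
    CCover m ((c, a) :: t) B ↔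
      (∃ B', B = (c, a) :: B' ∧ t ≠ [] ∧ CCover m t B') ∨
      B = (c, a + 1) :: t ∨
      (∃ h, h < a ∧ B = (c, h + 1) :: (c, a - h) :: t) ∨
      (∃ d h, d ≠ c ∧ h ≤ a ∧ B = ((if h = 0 then [] else [(c, h)]) ++ (d, 1) ::
            (if h = a then [] else [(c, a - h)])) ++ t) := by
  constructor
  · rintro (⟨h, _⟩ | ⟨l, r, c', a', h1, h2⟩ | ⟨l, r, c', a', k, hk, h1, h2⟩ |
      ⟨l, r, c', d, a', k, hd, hk, h1, h2⟩)
    · simp at h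
    · cases l with
      | nil => simp at h1; grind
      | cons z l =>
        simp at h1
        obtain ⟨rfl, h1⟩ := h1
        exact Or.inl ⟨_, h2, by simp [h1], Or.inr (Or.inl ⟨l, r, c', a', h1, rfl⟩)⟩
    · cases l with
      | nil =>
        simp at h1 h2
        obtain ⟨⟨rfl, rfl⟩, rfl⟩ := h1
        exact Or.inr (Or.inr (Or.inl ⟨k, hk, h2⟩))
      | cons z l =>
        simp at h1
        obtain ⟨rfl, h1⟩ := h1
        exact Or.inl ⟨_, h2, by simp [h1],
          Or.inr (Or.inr (Or.inl ⟨l, r, c', a', k, hk, h1, rfl⟩))⟩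
    · cases l with
      | nil =>
        simp only [List.nil_append, List.cons.injEq, Prod.mk.injEq] at h1 h2
        obtain ⟨⟨rfl, rfl⟩, rfl⟩ := h1
        exact Or.inr (Or.inr (Or.inr ⟨d, k, hd, hk, h2⟩))
      | cons z l =>
        simp only [List.cons_append, List.cons.injEq] at h1
        obtain ⟨rfl, h1⟩ := h1
        refine Or.inl ⟨_, h2, by simp [h1],
          Or.inr (Or.inr (Or.inr ⟨l, r, c', d, a', k, hd, hk, h1, by simp⟩))⟩
  · rintro (⟨B', rfl, ht, h⟩ | rfl | ⟨k, hk, rfl⟩ | ⟨d, k, hd, hk, rfl⟩)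
    · cases t with
      | nil => simp at ht
      | cons q L => exact cover_cons _ _ _ _ h
    · exact Or.inr (Or.inl ⟨[], t, c, a, rfl, rfl⟩)
    · exact Or.inr (Or.inr (Or.inl ⟨[], t, c, a, k, hk, rfl, rfl⟩))
    · exact Or.inr (Or.inr (Or.inr ⟨[], t, c, d, a, k, hd, hk, rfl, by simp⟩))

theorem cover_bump (c : Fin m) (a b : ℕ) (t s : List (Fin m × ℕ))
    (h : CCover m ((c, a) :: t) ((c, b) :: s)) :
    CCover m ((c, a + 1) :: t) ((c, b + 1) :: s) := by
  rw [cover_cons_iff] at h ⊢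
  rcases h with ⟨B', h1, ht, h⟩ | h1 | ⟨k, hk, h1⟩ | ⟨d, k, hd, hk, h1⟩
  · simp at h1
    obtain ⟨rfl, rfl⟩ := h1
    exact Or.inl ⟨_, rfl, ht, h⟩
  · simp at h1
    obtain ⟨rfl, rfl⟩ := h1
    exact Or.inr (Or.inl rfl)
  · simp at h1
    obtain ⟨rfl, rfl⟩ := h1
    exact Or.inr (Or.inr (Or.inl ⟨k + 1, by omega, by simp⟩))
  · refine Or.inr (Or.inr (Or.inr ⟨d, k + 1, hd, by omega, ?_⟩))
    by_cases hk0 : k = 0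
    · simp [hk0] at h1
      exact absurd h1.1.1.symm hd
    · simp [hk0] at h1
      simp [h1]

/-- Inserting a maximal letter gives a cover. -/
theorem cover_insert (N : ℕ) (c : Fin m) (x y : List (Fin m × ℕ))
    (h : ∀ p ∈ x ++ y, p.2 < N) :
    CCover m (cdc (x ++ y)) (cdc (x ++ (c, N) :: y)) := by
  induction x with
  | nil =>
    simp only [List.nil_append] at h ⊢
    rw [cdc_max c N y h]
    cases y with
    | nil => exact Or.inl ⟨rfl, c, rfl⟩
    | cons z y =>
      obtain ⟨a, t, e⟩ := cdc_head z.1 z.2 y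
      change cdc (z :: y) = _ at e
      rw [e]
      exact cover_front _ _ _ _ (by omega)
  | cons z x ih =>
    obtain ⟨c0, v⟩ := z
    have hv : v < N := h (c0, v) (by simp)
    have h' : ∀ p ∈ x ++ y, p.2 < N := fun p hp => h p (by simp at hp ⊢; tauto)
    cases x with
    | nil =>
      simp only [List.nil_append, List.cons_append] at h' ⊢
      by_cases hc : c = c0
      · subst hc
        rw [cdc_second_eq _ _ _ _ h' hv]
        cases y with
        | nil =>
          rw [cdc_single, cover_cons_iff]
          exact Or.inr (Or.inl rfl)
        | cons z y =>
          obtain ⟨c2, v2⟩ := z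
          by_cases hj : c = c2 ∧ v < v2
          · obtain ⟨rfl, hj⟩ := hj
            obtain ⟨a, t, e⟩ := cdc_head c v2 y
            rw [cdc_join hj e, e, cover_cons_iff]
            exact Or.inr (Or.inr (Or.inl ⟨1, by omega, by simp⟩))
          · rw [cdc_nojoin hj, cover_cons_iff]
            exact Or.inr (Or.inl rfl)
      · rw [cdc_second_ne _ _ hc _ _ _ h']
        cases y with
        | nil =>
          rw [cdc_single, cover_cons_iff]
          exact Or.inr (Or.inr (Or.inr ⟨c, 1, hc, by omega, by simp [cdc]⟩))
        | cons z y =>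
          obtain ⟨c2, v2⟩ := z
          by_cases hj : c0 = c2 ∧ v < v2
          · obtain ⟨rfl, hj⟩ := hj
            obtain ⟨a, t, e⟩ := cdc_head c0 v2 y
            rw [cdc_join hj e, e, cover_cons_iff]
            exact Or.inr (Or.inr (Or.inr ⟨c, 1, hc, by omega, by simp⟩))
          · rw [cdc_nojoin hj, cover_cons_iff]
            exact Or.inr (Or.inr (Or.inr ⟨c, 1, hc, by omega, by simp⟩))
    | cons z2 x =>
      obtain ⟨c2, v2⟩ := z2
      have ih := ih h'
      simp only [List.cons_append] at ih ⊢
      obtain ⟨a, t, e⟩ := cdc_head c2 v2 (x ++ y)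
      obtain ⟨b, s, e'⟩ := cdc_head c2 v2 (x ++ (c, N) :: y)
      by_cases hj : c0 = c2 ∧ v < v2
      · obtain ⟨rfl, hj⟩ := hj
        rw [cdc_join hj e, cdc_join hj e']
        rw [e, e'] at ih
        exact cover_bump _ _ _ _ _ ih
      · rw [cdc_nojoin hj, cdc_nojoin hj]
        rw [e, e'] at ih ⊢
        exact cover_cons _ _ _ _ ih

/-- Every cover comes from inserting a maximal letter. -/
theorem exists_insert (N : ℕ) (u : List (Fin m × ℕ)) (hu : ∀ p ∈ u, p.2 < N)
    (B : List (Fin m × ℕ)) (hB : CCover m (cdc u) B) :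
    ∃ x y c, u = x ++ y ∧ cdc (x ++ (c, N) :: y) = B := by
  induction u generalizing B with
  | nil =>
    rcases hB with ⟨_, c, rfl⟩ | ⟨l, r, c, a, h1, h2⟩ | ⟨l, r, c, a, k, hk, h1, h2⟩ |
      ⟨l, r, c, d, a, k, hd, hk, h1, h2⟩
    · exact ⟨[], [], c, rfl, cdc_single c N⟩
    all_goals simp [cdc] at h1
  | cons z u ih =>
    obtain ⟨c0, v⟩ := z
    have hv : v < N := hu (c0, v) (by simp)
    have hu' : ∀ p ∈ u, p.2 < N := fun p hp => hu p (by simp [hp])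
    have ih := ih hu'
    have front : ∀ d, B = (d, 1) :: cdc ((c0, v) :: u) → ∃ x y c, (c0, v) :: u = x ++ y ∧
        cdc (x ++ (c, N) :: y) = B :=
      fun d h => ⟨[], (c0, v) :: u, d, rfl, by rw [h]; exact cdc_max _ _ _ hu⟩
    have secondE : B = (c0, 2) :: cdc u → ∃ x y c, (c0, v) :: u = x ++ y ∧
        cdc (x ++ (c, N) :: y) = B :=
      fun h => ⟨[(c0, v)], u, c0, rfl, by rw [h]; exact cdc_second_eq _ _ _ _ hu' hv⟩
    have secondN : ∀ d, d ≠ c0 → B = (c0, 1) :: (d, 1) :: cdc u →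
        ∃ x y c, (c0, v) :: u = x ++ y ∧ cdc (x ++ (c, N) :: y) = B :=
      fun d hd h => ⟨[(c0, v)], u, d, rfl, by rw [h]; exact cdc_second_ne _ _ hd _ _ _ hu'⟩
    by_cases hj : ∃ v2 u', u = (c0, v2) :: u' ∧ v < v2
    · obtain ⟨v2, u', rfl, hj⟩ := hj
      obtain ⟨a, t, e⟩ := cdc_head c0 v2 u'
      have e1 := cdc_join hj e
      -- lifting an insertion which is not at the front
      have lift : ∀ b s, B = (c0, b + 1) :: s → CCover m ((c0, a + 1) :: t) ((c0, b) :: s) →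
          ((c0, b) :: s = (c0, 1) :: (c0, a + 1) :: t → B = (c0, 2) :: (c0, a + 1) :: t) →
          ∃ x y c, (c0, v) :: (c0, v2) :: u' = x ++ y ∧ cdc (x ++ (c, N) :: y) = B := by
        intro b s hb hc hs
        rw [e] at ih
        obtain ⟨x, y, c, h1, h2⟩ := ih _ hc
        cases x with
        | nil =>
          simp only [List.nil_append] at h1 h2
          subst h1
          rw [cdc_max _ _ _ hu', e] at h2
          apply secondE
          rw [e]
          apply hs
          rw [← h2]
          simp at h2 ⊢
          exact h2.1.1
        | cons z2 x =>
          simp only [List.cons_append, List.cons.injEq] at h1 h2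
          obtain ⟨rfl, rfl⟩ := h1
          exact ⟨(c0, v) :: (c0, v2) :: x, y, c, rfl, by rw [hb]; exact cdc_join hj h2⟩
      rw [e1, cover_cons_iff] at hB
      rw [e1] at front
      rw [e] at secondE secondN
      rcases hB with ⟨B', h1, ht, h⟩ | h1 | ⟨k, hk, h1⟩ | ⟨d, k, hd, hk, h1⟩
      · refine lift (a + 1) B' h1 ?_ ?_
        · rw [cover_cons_iff]
          exact Or.inl ⟨_, rfl, ht, h⟩
        · intro h3
          simp at h3
          simp [h1, h3]
      · refine lift (a + 2) t h1 ?_ ?_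
        · rw [cover_cons_iff]
          exact Or.inr (Or.inl rfl)
        · intro h3
          simp at h3
      · cases k with
        | zero => exact front c0 (by simpa using h1)
        | succ k =>
          refine lift (k + 1) _ h1 ?_ ?_
          · rw [cover_cons_iff]
            refine Or.inr (Or.inr (Or.inl ⟨k, by omega, by simp⟩))
          · intro h3
            simp at h3
            simp [h1, h3]
      · cases k with
        | zero => exact front d (by simpa using h1)
        | succ k =>
          cases k with
          | zero => exact secondN d hd (by simpa using h1)
          | succ k =>
            refine lift (k + 1) ((d, 1) :: (if k + 2 = a + 2 then [] else
              [(c0, a + 2 - (k + 2))]) ++ t) (by simpa using h1) ?_ ?_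
            · rw [cover_cons_iff]
              refine Or.inr (Or.inr (Or.inr ⟨d, k + 1, hd, by omega, by simp⟩))
            · intro h3
              simp at h3
              exact absurd h3.2.1.1 hd
    · have e1 : cdc ((c0, v) :: u) = (c0, 1) :: cdc u := by
        cases u with
        | nil => rfl
        | cons z2 u =>
          obtain ⟨c2, v2⟩ := z2
          apply cdc_nojoin
          rintro ⟨rfl, h⟩
          exact hj ⟨_, _, rfl, h⟩
      rw [e1, cover_cons_iff] at hB
      rw [e1] at front
      rcases hB with ⟨B', h1, ht, h⟩ | h1 | ⟨k, hk, h1⟩ | ⟨d, k, hd, hk, h1⟩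
      · obtain ⟨x, y, c, h3, h2⟩ := ih _ h
        cases x with
        | nil =>
          simp only [List.nil_append] at h3 h2
          subst h3
          rw [cdc_max _ _ _ hu'] at h2
          by_cases hc : c = c0
          · exact front c0 (by rw [h1, ← h2, hc])
          · exact secondN c hc (by rw [h1, ← h2])
        | cons z2 x =>
          obtain ⟨c2, v2⟩ := z2
          refine ⟨(c0, v) :: (c2, v2) :: x, y, c, by simp [h3], ?_⟩
          rw [h1, ← h2]
          apply cdc_nojoin
          rintro ⟨rfl, h⟩
          exact hj ⟨_, _, h3, h⟩
      · exact secondE h1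
      · obtain rfl : k = 0 := by omega
        exact front c0 (by simpa using h1)
      · obtain rfl | rfl : k = 0 ∨ k = 1 := by omega
        · exact front d (by simpa using h1)
        · exact secondN d hd (by simpa using h1)

theorem front_ne (N : ℕ) (c d : Fin m) (z : Fin m × ℕ) (x y : List (Fin m × ℕ))
    (h : ∀ p ∈ z :: (x ++ y), p.2 < N) :
    (c, 1) :: cdc (z :: (x ++ y)) ≠ cdc (z :: (x ++ (d, N) :: y)) := by
  induction x generalizing c z with
  | nil =>
    obtain ⟨c0, v⟩ := z
    have hv : v < N := h (c0, v) (by simp)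
    have h' : ∀ p ∈ y, p.2 < N := fun p hp => h p (by simp [hp])
    intro he
    simp only [List.nil_append] at he
    by_cases hd : d = c0
    · subst hd
      rw [cdc_second_eq _ _ _ _ h' hv] at he
      simp at he
    · rw [cdc_second_ne _ _ hd _ _ _ h'] at he
      obtain ⟨a, t, e⟩ := cdc_head c0 v y
      rw [e] at he
      simp at he
      exact hd he.2.1.1.symm
  | cons z2 x ih =>
    obtain ⟨c0, v⟩ := z
    obtain ⟨c2, v2⟩ := z2
    intro he
    simp only [List.cons_append] at he
    by_cases hj : c0 = c2 ∧ v < v2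
    · obtain ⟨rfl, hj⟩ := hj
      obtain ⟨b, s, e'⟩ := cdc_head c0 v2 (x ++ (d, N) :: y)
      rw [cdc_join hj e'] at he
      simp at he
    · rw [cdc_nojoin hj, cdc_nojoin hj] at he
      simp only [List.cons.injEq] at he
      exact ih c0 (c2, v2) (fun p hp => h p (by simp at hp ⊢; tauto)) he.2

theorem insert_unique (N : ℕ) (c c' : Fin m) (x y x' y' : List (Fin m × ℕ))
    (hxy : x ++ y = x' ++ y') (h : ∀ p ∈ x ++ y, p.2 < N)
    (he : cdc (x ++ (c, N) :: y) = cdc (x' ++ (c', N) :: y')) :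
    x ++ (c, N) :: y = x' ++ (c', N) :: y' := by
  induction x generalizing x' with
  | nil =>
    simp only [List.nil_append] at *
    rw [cdc_max _ _ _ h] at he
    cases x' with
    | nil =>
      simp only [List.nil_append] at *
      subst hxy
      rw [cdc_max _ _ _ h] at he
      simp at he ⊢
      exact he
    | cons z x' =>
      subst hxy
      exact absurd he (front_ne _ _ _ _ _ _ h)
  | cons z x ih =>
    cases x' with
    | nil =>
      simp only [List.nil_append] at hxy he
      rw [cdc_max _ _ _ (by rw [← hxy]; exact h), ← hxy] at he
      exact absurd he.symm (front_ne _ _ _ _ _ _ h)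
    | cons z' x' =>
      simp only [List.cons_append, List.cons.injEq] at hxy
      obtain ⟨rfl, hxy⟩ := hxy
      have h' : ∀ p ∈ x ++ y, p.2 < N := fun p hp => h p (by simp at hp ⊢; tauto)
      have key : ∀ (c c' : Fin m) (w : List (Fin m × ℕ)) (z2 : Fin m × ℕ)
          (x' y' : List (Fin m × ℕ)), w = z2 :: (x' ++ y') → (∀ p ∈ w, p.2 < N) →
          cdc (z :: (c, N) :: w) ≠ cdc (z :: z2 :: (x' ++ (c', N) :: y')) := by
        intro c c' w z2 x' y' hw hwN he
        subst hw
        obtain ⟨c0, v⟩ := z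
        obtain ⟨c2, v2⟩ := z2
        have hv : v < N := h (c0, v) (by simp)
        obtain ⟨b, s, e'⟩ := cdc_head c2 v2 (x' ++ (c', N) :: y')
        by_cases hc : c = c0
        · subst hc
          rw [cdc_second_eq _ _ _ _ hwN hv] at he
          by_cases hj : c = c2 ∧ v < v2
          · obtain ⟨rfl, hj⟩ := hj
            rw [cdc_join hj e'] at he
            apply front_ne N c c' _ _ _ hwN
            rw [e']
            simp at he ⊢
            exact he
          · rw [cdc_nojoin hj] at he
            simp at he
        · rw [cdc_second_ne _ _ hc _ _ _ hwN] at he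
          by_cases hj : c0 = c2 ∧ v < v2
          · obtain ⟨rfl, hj⟩ := hj
            rw [cdc_join hj e'] at he
            simp at he
          · rw [cdc_nojoin hj] at he
            simp only [List.cons.injEq, true_and] at he
            exact front_ne N c c' _ _ _ hwN he
      simp only [List.cons_append] at he ⊢
      congr 1
      cases x with
      | nil =>
        cases x' with
        | nil => 
          apply ih _ hxy h'
          simp only [List.nil_append] at hxy h' he ⊢
          subst hxy
          obtain ⟨c0, v⟩ := z
          have hv : v < N := h (c0, v) (by simp)
          rw [cdc_max _ _ _ h', cdc_max _ _ _ h']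
          by_cases hc : c = c0 <;> by_cases hc' : c' = c0
          · rw [hc, hc']
          · subst hc
            rw [cdc_second_eq _ _ _ _ h' hv, cdc_second_ne _ _ hc' _ _ _ h'] at he
            simp at he
          · subst hc'
            rw [cdc_second_eq _ _ _ _ h' hv, cdc_second_ne _ _ hc _ _ _ h'] at he
            simp at he
          · rw [cdc_second_ne _ _ hc _ _ _ h', cdc_second_ne _ _ hc' _ _ _ h'] at he
            simpa using he
        | cons z2 x' => exact absurd he (key _ _ _ _ _ _ hxy h')
      | cons z2 x =>
        cases x' with
        | nil => exact absurd he.symm (key _ _ _ _ _ _ hxy.symm (by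
            intro p hp
            apply h'
            rw [hxy]
            exact hp))
        | cons z3 x' =>
          apply ih _ hxy h'
          simp only [List.cons_append, List.cons.injEq] at hxy he ⊢
          obtain ⟨rfl, hxy⟩ := hxy
          obtain ⟨c0, v⟩ := z
          obtain ⟨c2, v2⟩ := z2
          obtain ⟨a, t, e⟩ := cdc_head c2 v2 (x ++ (c, N) :: y)
          obtain ⟨b, s, e'⟩ := cdc_head c2 v2 (x' ++ (c', N) :: y')
          by_cases hj : c0 = c2 ∧ v < v2
          · obtain ⟨rfl, hj⟩ := hj
            rw [cdc_join hj e, cdc_join hj e'] at he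
            rw [e, e']
            simpa using he
          · rw [cdc_nojoin hj, cdc_nojoin hj] at he
            simpa using he

/-- Saturated chains of length `n` ending at `α`. -/
abbrev ChainsTo (m n : ℕ) (α : List (Fin m × ℕ)) :=
  {c : Fin (n + 1) → List (Fin m × ℕ) //
        c 0 = [] ∧ c (Fin.last n) = α ∧
        ∀ i : Fin n, CCover m (c i.castSucc) (c i.succ)}

/-- Colored permutation words of `0, ..., n-1` with descent composition `α`. -/
abbrev WordsTo (m n : ℕ) (α : List (Fin m × ℕ)) :=
  {u : List (Fin m × ℕ) // (u.map Prod.snd).Perm (List.range n) ∧ cdc u = α}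

theorem chains_step (n : ℕ) (α : List (Fin m × ℕ)) :
    Nonempty (ChainsTo m (n + 1) α ≃ Σ β : {β // CCover m β α}, ChainsTo m n β.1) := by
  refine ⟨Equiv.ofBijective (fun c => ⟨⟨c.1 (Fin.last n).castSucc, ?_⟩,
    ⟨fun i => c.1 i.castSucc, ?_, rfl, ?_⟩⟩) ⟨?_, ?_⟩⟩
  · have := c.2.2.2 (Fin.last n)
    rw [Fin.succ_last, c.2.2.1] at this
    exact this
  · exact c.2.1
  · intro i
    exact c.2.2.2 i.castSucc
  · intro c c' h
    have h2 := congrArg (fun s => s.2.1) h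
    apply Subtype.ext
    funext i
    refine Fin.lastCases ?_ (fun i => ?_) i
    · rw [c.2.2.1, c'.2.2.1]
    · exact congrFun h2 i
  · rintro ⟨⟨β, hβ⟩, ⟨c, h0, h1, h2⟩⟩
    simp only at h1
    subst h1
    refine ⟨⟨Fin.snoc (α := fun _ => List (Fin m × ℕ)) c α, ?_, ?_, ?_⟩, ?_⟩
    · rw [← Fin.castSucc_zero, Fin.snoc_castSucc]; exact h0
    · simp
    · intro i
      refine Fin.lastCases ?_ (fun i => ?_) i
      · rw [Fin.snoc_castSucc, Fin.succ_last, Fin.snoc_last]; exact hβ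
      · rw [Fin.snoc_castSucc, Fin.succ_castSucc, Fin.snoc_castSucc]; exact h2 i
    · have e : ∀ i, Fin.snoc (α := fun _ => List (Fin m × ℕ)) c α (Fin.castSucc i) = c i :=
        fun i => Fin.snoc_castSucc (α := fun _ => List (Fin m × ℕ)) α c i
      exact Sigma.subtype_ext (Subtype.ext (e _)) (funext e)

theorem word_split (n : ℕ) (u : List (Fin m × ℕ))
    (h : (u.map Prod.snd).Perm (List.range (n + 1))) :
    ∃ x y c, u = x ++ (c, n) :: y ∧ u.filter (fun p => p.2 < n) = x ++ y ∧
      ((x ++ y).map Prod.snd).Perm (List.range n) := by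
  have hn : n ∈ u.map Prod.snd := h.mem_iff.2 (by simp)
  obtain ⟨⟨c, k⟩, hp, hk⟩ := List.mem_map.1 hn
  simp only at hk
  subst hk
  obtain ⟨x, y, rfl⟩ := List.append_of_mem hp
  have h3 : ((x ++ y).map Prod.snd).Perm (List.range k) := by
    rw [List.range_succ] at h
    have h1 : (k :: (x ++ y).map Prod.snd).Perm (k :: List.range k) := by
      refine List.Perm.trans ?_ (h.trans List.perm_append_comm)
      simp only [List.map_append, List.map_cons]
      exact List.perm_middle.symm
    exact (List.perm_cons k).1 h1
  have hlt : ∀ p ∈ x ++ y, p.2 < k := fun p hp =>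
    List.mem_range.1 (h3.mem_iff.1 (List.mem_map_of_mem hp))
  refine ⟨x, y, c, rfl, ?_, h3⟩
  rw [List.filter_append, List.filter_cons_of_neg (by simp), ← List.filter_append]
  exact List.filter_eq_self.2 (fun p hp => by simpa using hlt p hp)

theorem perm_lt {n : ℕ} {u : List (Fin m × ℕ)} (h : (u.map Prod.snd).Perm (List.range n)) :
    ∀ p ∈ u, p.2 < n := fun _ hp =>
  List.mem_range.1 (h.mem_iff.1 (List.mem_map_of_mem hp))

theorem words_step (n : ℕ) (α : List (Fin m × ℕ)) :
    Nonempty (WordsTo m (n + 1) α ≃ Σ β : {β // CCover m β α}, WordsTo m n β.1) := by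
  refine ⟨Equiv.ofBijective (fun u => ⟨⟨cdc (u.1.filter (fun p => p.2 < n)), ?_⟩,
    ⟨u.1.filter (fun p => p.2 < n), ?_, rfl⟩⟩) ⟨?_, ?_⟩⟩
  · obtain ⟨u, hu, rfl⟩ := u
    obtain ⟨x, y, c, rfl, hf, hp⟩ := word_split n u hu
    simp only [hf]
    exact cover_insert n c x y (perm_lt hp)
  · obtain ⟨u, hu, rfl⟩ := u
    obtain ⟨x, y, c, rfl, hf, hp⟩ := word_split n u hu
    simp only [hf]
    exact hp
  · rintro ⟨u, hu, rfl⟩ ⟨u', hu', he⟩ h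
    have h2 := congrArg (fun s => s.2.1) h
    simp only at h2
    obtain ⟨x, y, c, rfl, hf, hp⟩ := word_split n u hu
    obtain ⟨x', y', c', rfl, hf', hp'⟩ := word_split n u' hu'
    rw [hf, hf'] at h2
    exact Subtype.ext (insert_unique n c c' x y x' y' h2 (perm_lt hp) he.symm)
  · rintro ⟨⟨β, hβ⟩, ⟨u, hu, h1⟩⟩
    simp only at h1
    subst h1
    obtain ⟨x, y, c, rfl, h2⟩ := exists_insert n u (perm_lt hu) α hβ
    have hf : (x ++ (c, n) :: y).filter (fun p => p.2 < n) = x ++ y := by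
      rw [List.filter_append, List.filter_cons_of_neg (by simp), ← List.filter_append]
      exact List.filter_eq_self.2 (fun p hp => by simpa using perm_lt hu p hp)
    refine ⟨⟨x ++ (c, n) :: y, ?_, h2⟩, ?_⟩
    · rw [List.range_succ]
      refine List.Perm.trans ?_ ((List.Perm.cons n hu).trans
        (List.perm_append_comm (l₁ := [n])))
      simp only [List.map_append, List.map_cons]
      exact List.perm_middle
    · exact Sigma.subtype_ext (Subtype.ext (congrArg cdc hf)) hf

theorem chains_words (n : ℕ) : ∀ α : List (Fin m × ℕ),
    Nonempty (ChainsTo m n α ≃ WordsTo m n α) := by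
  induction n with
  | zero =>
    intro α
    refine ⟨⟨fun c => ⟨[], by simp, ?_⟩, fun u => ⟨fun _ => [], rfl, ?_, fun i => i.elim0⟩,
      ?_, ?_⟩⟩
    · rw [← c.2.2.1]; exact c.2.1.symm
    · obtain ⟨u, hu, rfl⟩ := u
      simp at hu
      subst hu; rfl
    · intro c
      apply Subtype.ext
      funext i
      rw [Fin.fin_one_eq_zero i]
      exact c.2.1.symm
    · rintro ⟨u, hu, rfl⟩
      simp at hu
      subst hu; rfl
  | succ n ih =>
    intro α
    obtain ⟨e1⟩ := chains_step n α
    obtain ⟨e2⟩ := words_step n α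
    exact ⟨e1.trans ((Equiv.sigmaCongrRight fun β : {β // CCover m β α} => (ih β.1).some).trans e2.symm)⟩

theorem words_perms (n : ℕ) (α : List (Fin m × ℕ)) :
    Nonempty ({u : Equiv.Perm (Fin n) × (Fin n → Fin m) // cdc (cword u.1 u.2) = α} ≃
      WordsTo m n α) := by
  refine ⟨Equiv.ofBijective (fun u => ⟨cword u.1.1 u.1.2, ?_, u.2⟩) ⟨?_, ?_⟩⟩
  · obtain ⟨⟨w, f⟩, h⟩ := u
    simp only [cword, List.map_map]
    refine (List.perm_ext_iff_of_nodup ?_ List.nodup_range).2 ?_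
    · refine (List.nodup_finRange n).map ?_
      intro i j hij
      simpa [Fin.val_inj] using hij
    · intro k
      simp only [List.mem_map, List.mem_finRange, true_and, Function.comp, List.mem_range]
      constructor
      · rintro ⟨i, rfl⟩; exact (w i).2
      · intro hk; exact ⟨w.symm ⟨k, hk⟩, by simp⟩
  · rintro ⟨⟨w, f⟩, h⟩ ⟨⟨w', f'⟩, h'⟩ he
    have he := congrArg Subtype.val he
    simp only [cword] at he
    rw [List.map_inj_left] at he
    have hw : w = w' := by
      ext i
      have := he i (by simp)
      simp at this
      exact this.2
    subst hw
    have hf : f = f' := by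
      funext k
      have := he (w.symm k) (by simp)
      simpa using this
    subst hf
    rfl
  · rintro ⟨u, hu, rfl⟩
    have hlen : u.length = n := by simpa using hu.length_eq
    subst hlen
    have hnd : (u.map Prod.snd).Nodup := hu.nodup_iff.2 List.nodup_range
    let g : Fin u.length → Fin u.length := fun i => ⟨(u.get i).2, perm_lt hu _ (List.get_mem _ _)⟩
    have hg : Function.Injective g := by
      intro i j hij
      simp only [g, Fin.mk.injEq] at hij
      have := (List.Nodup.getElem_inj_iff hnd (i := i.1) (j := j.1) (hi := by simp)
        (hj := by simp)).1 (by simpa using hij)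
      exact Fin.ext this
    let w : Equiv.Perm (Fin u.length) := Equiv.ofBijective g (Finite.injective_iff_bijective.1 hg)
    have hc : cword w (fun k => (u.get (w.symm k)).1) = u := by
      apply List.ext_get
      · simp [cword]
      · intro i h1 h2
        simp [cword]
        rfl
    exact ⟨⟨(w, fun k => (u.get (w.symm k)).1), by rw [hc]⟩, Subtype.ext hc⟩

end helpers

/-- The number of saturated chains from `∅` to an `m`-colored composition `α` of
`n` in `Co^(m)` equals the number `f_n^(m)(α)` of `m`-colored permutations of
`[n]` with colored descent composition `α`. -/
theorem card_saturated_chains_eq (m n : ℕ) (hm : 1 ≤ m)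
    (α : List (Fin m × ℕ)) (hpos : ∀ p ∈ α, 0 < p.2)
    (hsum : (α.map Prod.snd).sum = n) :
    Nat.card {c : Fin (n + 1) → List (Fin m × ℕ) //
        c 0 = [] ∧ c (Fin.last n) = α ∧
        ∀ i : Fin n, CCover m (c i.castSucc) (c i.succ)} =
    Nat.card {u : Equiv.Perm (Fin n) × (Fin n → Fin m) //
        cdc (cword u.1 u.2) = α} := by
  rw [Nat.card_congr (chains_words n α).some, Nat.card_congr (words_perms n α).some]
end
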